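/- arXiv:1905.05174 — 8 statements merged into one kernel-verified Lean document; each statement's English description precedes it below -/
import Mathlib

section
/- For all real parameters n_{2,1}, n_{1,3}, n_{1,3̄}, n_{2,3}, n_{2,3̄}, n_{3,1}, n_{1,8}, writing n13b = n_{1,3}+n_{1,3̄} and n23b = n_{2,3}+n_{2,3̄}, and for all real (ψ₁,φ₁,φ₂) with 0 < φ₂−φ₁ < φ₁ < φ₂ < ψ₁ (chamber 1), the one-loop prepotential satisfies 6F(ψ₁,φ₁,φ₂) = −8(n_{1,8}−1)φ₁³ − (3/2)(n13b − 2n_{1,8} + 2)φ₁²φ₂ + (3/2)(n13b + 2n_{1,8} − 2)φ₁φ₂² + (−n13b − 8n_{1,8} + 8)φ₂³ − (n_{2,1} + 3·n23b + 8n_{3,1} − 8)ψ₁³ − 6·n23b·ψ₁(φ₁² − φ₁φ₂ + φ₂²). -/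
/-- Six times the one-loop prepotential of the SU(2)×SU(3)-model with matter in
the representation (2,1)⊕(1,3)⊕(1,3̄)⊕(2,3)⊕(2,3̄)⊕(3,1)⊕(1,8), as a function of
the Coulomb branch coordinates (ψ₁, φ₁, φ₂) and the (real) numbers of
hypermultiplets in each irreducible representation. -/
noncomputable def sixPrepotential (n21 n13 n13bar n23 n23bar n31 n18 ψ₁ φ₁ φ₂ : ℝ) : ℝ :=
  (1 / 2) *
    (2 * (|2 * ψ₁| ^ 3 + |2 * φ₁ - φ₂| ^ 3 + |-φ₁ + 2 * φ₂| ^ 3 + |φ₁ + φ₂| ^ 3)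
      - 2 * n21 * |ψ₁| ^ 3
      - (n13 + n13bar) * (|φ₁| ^ 3 + |-φ₁ + φ₂| ^ 3 + |φ₂| ^ 3)
      - (n23 + n23bar) *
          (|ψ₁ + φ₁| ^ 3 + |ψ₁ - φ₁| ^ 3 + |ψ₁ - φ₁ + φ₂| ^ 3
            + |ψ₁ + φ₁ - φ₂| ^ 3 + |ψ₁ - φ₂| ^ 3 + |ψ₁ + φ₂| ^ 3)
      - 2 * n31 * |2 * ψ₁| ^ 3
      - 2 * n18 * (|2 * φ₁ - φ₂| ^ 3 + |-φ₁ + 2 * φ₂| ^ 3 + |φ₁ + φ₂| ^ 3))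

/-- The one-loop prepotential of the SU(2)×SU(3)-model in chamber 1
(`0 < φ₂−φ₁ < φ₁ < φ₂ < ψ₁`). -/
theorem su2su3_prepotential_chamber_one
    (n21 n13 n13bar n23 n23bar n31 n18 : ℝ) (ψ₁ φ₁ φ₂ : ℝ)
    (h1 : 0 < φ₂ - φ₁) (h2 : φ₂ - φ₁ < φ₁) (h3 : φ₁ < φ₂) (h4 : φ₂ < ψ₁) :
    sixPrepotential n21 n13 n13bar n23 n23bar n31 n18 ψ₁ φ₁ φ₂ =
      -8 * (n18 - 1) * φ₁ ^ 3
      - (3 / 2) * ((n13 + n13bar) - 2 * n18 + 2) * φ₁ ^ 2 * φ₂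
      + (3 / 2) * ((n13 + n13bar) + 2 * n18 - 2) * φ₁ * φ₂ ^ 2
      + (-(n13 + n13bar) - 8 * n18 + 8) * φ₂ ^ 3
      - (n21 + 3 * (n23 + n23bar) + 8 * n31 - 8) * ψ₁ ^ 3
      - 6 * (n23 + n23bar) * ψ₁ * (φ₁ ^ 2 - φ₁ * φ₂ + φ₂ ^ 2) := by
  unfold sixPrepotential
  rw [abs_of_pos (show 0 < 2 * ψ₁ by linarith),
    abs_of_pos (show 0 < 2 * φ₁ - φ₂ by linarith),
    abs_of_pos (show 0 < -φ₁ + 2 * φ₂ by linarith),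
    abs_of_pos (show 0 < φ₁ + φ₂ by linarith),
    abs_of_pos (show 0 < ψ₁ by linarith),
    abs_of_pos (show 0 < φ₁ by linarith),
    abs_of_pos (show 0 < -φ₁ + φ₂ by linarith),
    abs_of_pos (show 0 < φ₂ by linarith),
    abs_of_pos (show 0 < ψ₁ + φ₁ by linarith),
    abs_of_pos (show 0 < ψ₁ - φ₁ by linarith),
    abs_of_pos (show 0 < ψ₁ - φ₁ + φ₂ by linarith),
    abs_of_pos (show 0 < ψ₁ + φ₁ - φ₂ by linarith),
    abs_of_pos (show 0 < ψ₁ - φ₂ by linarith),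
    abs_of_pos (show 0 < ψ₁ + φ₂ by linarith)]
  ring
end

section
/- For all real parameters n_{2,1}, n_{1,3}, n_{1,3̄}, n_{2,3}, n_{2,3̄}, n_{3,1}, n_{1,8}, writing n13b = n_{1,3}+n_{1,3̄} and n23b = n_{2,3}+n_{2,3̄}, and for all real (ψ₁,φ₁,φ₂) with 0 < φ₂−φ₁ < φ₁ < ψ₁ < φ₂ (chamber 2), the one-loop prepotential satisfies 6F(ψ₁,φ₁,φ₂) = −8(n_{1,8}−1)φ₁³ − (3/2)(n13b − 2n_{1,8} + 2)φ₁²φ₂ + (3/2)(n13b + 2n_{1,8} − 2)φ₁φ₂² − (n13b + 8n_{1,8} + n23b − 8)φ₂³ − (n_{2,1} + 2·n23b + 8n_{3,1} − 8)ψ₁³ − 3·n23b·ψ₁²φ₂ − 3·n23b·ψ₁(2φ₁² − 2φ₁φ₂ + φ₂²). -/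
/-- The one-loop prepotential of the SU(2)×SU(3)-model in chamber 2
(`0 < φ₂−φ₁ < φ₁ < ψ₁ < φ₂`). -/
theorem su2su3_prepotential_chamber_two
    (n21 n13 n13bar n23 n23bar n31 n18 : ℝ) (ψ₁ φ₁ φ₂ : ℝ)
    (h1 : 0 < φ₂ - φ₁) (h2 : φ₂ - φ₁ < φ₁) (h3 : φ₁ < ψ₁) (h4 : ψ₁ < φ₂) :
    sixPrepotential n21 n13 n13bar n23 n23bar n31 n18 ψ₁ φ₁ φ₂ =
      -8 * (n18 - 1) * φ₁ ^ 3
      - (3 / 2) * ((n13 + n13bar) - 2 * n18 + 2) * φ₁ ^ 2 * φ₂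
      + (3 / 2) * ((n13 + n13bar) + 2 * n18 - 2) * φ₁ * φ₂ ^ 2
      - ((n13 + n13bar) + 8 * n18 + (n23 + n23bar) - 8) * φ₂ ^ 3
      - (n21 + 2 * (n23 + n23bar) + 8 * n31 - 8) * ψ₁ ^ 3
      - 3 * (n23 + n23bar) * ψ₁ ^ 2 * φ₂
      - 3 * (n23 + n23bar) * ψ₁ * (2 * φ₁ ^ 2 - 2 * φ₁ * φ₂ + φ₂ ^ 2) := by
  unfold sixPrepotential
  rw [abs_of_pos (show 0 < 2 * ψ₁ by linarith),
    abs_of_pos (show 0 < 2 * φ₁ - φ₂ by linarith),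
    abs_of_pos (show 0 < -φ₁ + 2 * φ₂ by linarith),
    abs_of_pos (show 0 < φ₁ + φ₂ by linarith),
    abs_of_pos (show 0 < ψ₁ by linarith),
    abs_of_pos (show 0 < φ₁ by linarith),
    abs_of_pos (show 0 < -φ₁ + φ₂ by linarith),
    abs_of_pos (show 0 < φ₂ by linarith),
    abs_of_pos (show 0 < ψ₁ + φ₁ by linarith),
    abs_of_pos (show 0 < ψ₁ - φ₁ by linarith),
    abs_of_pos (show 0 < ψ₁ - φ₁ + φ₂ by linarith),
    abs_of_pos (show 0 < ψ₁ + φ₁ - φ₂ by linarith),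
    abs_of_neg (show ψ₁ - φ₂ < 0 by linarith),
    abs_of_pos (show 0 < ψ₁ + φ₂ by linarith)]
  ring
end

section
/- For all real parameters n_{2,1}, n_{1,3}, n_{1,3̄}, n_{2,3}, n_{2,3̄}, n_{3,1}, n_{1,8}, writing n13b = n_{1,3}+n_{1,3̄} and n23b = n_{2,3}+n_{2,3̄}, and for all real (ψ₁,φ₁,φ₂) with 0 < φ₂−φ₁ < ψ₁ < φ₁ < φ₂ (chamber 3), the one-loop prepotential satisfies 6F(ψ₁,φ₁,φ₂) = −(8n_{1,8} + n23b − 8)φ₁³ − (3/2)(n13b − 2n_{1,8} + 2)φ₁²φ₂ + (3/2)(n13b + 2n_{1,8} − 2)φ₁φ₂² − (n13b + 8n_{1,8} + n23b − 8)φ₂³ − (n_{2,1} + n23b + 8n_{3,1} − 8)ψ₁³ − 3·n23b·ψ₁²(φ₁ + φ₂) − 3·n23b·ψ₁(φ₁² − 2φ₁φ₂ + φ₂²). -/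
/-- The one-loop prepotential of the SU(2)×SU(3)-model in chamber 3
(`0 < φ₂−φ₁ < ψ₁ < φ₁ < φ₂`). -/
theorem su2su3_prepotential_chamber_three
    (n21 n13 n13bar n23 n23bar n31 n18 : ℝ) (ψ₁ φ₁ φ₂ : ℝ)
    (h1 : 0 < φ₂ - φ₁) (h2 : φ₂ - φ₁ < ψ₁) (h3 : ψ₁ < φ₁) (h4 : φ₁ < φ₂) :
    sixPrepotential n21 n13 n13bar n23 n23bar n31 n18 ψ₁ φ₁ φ₂ =
      -(8 * n18 + (n23 + n23bar) - 8) * φ₁ ^ 3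
      - (3 / 2) * ((n13 + n13bar) - 2 * n18 + 2) * φ₁ ^ 2 * φ₂
      + (3 / 2) * ((n13 + n13bar) + 2 * n18 - 2) * φ₁ * φ₂ ^ 2
      - ((n13 + n13bar) + 8 * n18 + (n23 + n23bar) - 8) * φ₂ ^ 3
      - (n21 + (n23 + n23bar) + 8 * n31 - 8) * ψ₁ ^ 3
      - 3 * (n23 + n23bar) * ψ₁ ^ 2 * (φ₁ + φ₂)
      - 3 * (n23 + n23bar) * ψ₁ * (φ₁ ^ 2 - 2 * φ₁ * φ₂ + φ₂ ^ 2) := by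
  rw [sixPrepotential,
    abs_of_pos (show 0 < 2 * ψ₁ by linarith),
    abs_of_pos (show 0 < 2 * φ₁ - φ₂ by linarith),
    abs_of_pos (show 0 < -φ₁ + 2 * φ₂ by linarith),
    abs_of_pos (show 0 < φ₁ + φ₂ by linarith),
    abs_of_pos (show 0 < ψ₁ by linarith),
    abs_of_pos (show 0 < φ₁ by linarith),
    abs_of_pos (show 0 < -φ₁ + φ₂ by linarith),
    abs_of_pos (show 0 < φ₂ by linarith),
    abs_of_pos (show 0 < ψ₁ + φ₁ by linarith),
    abs_of_neg (show ψ₁ - φ₁ < 0 by linarith),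
    abs_of_pos (show 0 < ψ₁ - φ₁ + φ₂ by linarith),
    abs_of_pos (show 0 < ψ₁ + φ₁ - φ₂ by linarith),
    abs_of_neg (show ψ₁ - φ₂ < 0 by linarith),
    abs_of_pos (show 0 < ψ₁ + φ₂ by linarith)]
  ring
end

section
/- For all real parameters n_{2,1}, n_{1,3}, n_{1,3̄}, n_{2,3}, n_{2,3̄}, n_{3,1}, n_{1,8}, writing n13b = n_{1,3}+n_{1,3̄} and n23b = n_{2,3}+n_{2,3̄}, and for all real (ψ₁,φ₁,φ₂) with 0 < ψ₁ < φ₂−φ₁ < φ₁ < φ₂ (chamber 4), the one-loop prepotential satisfies 6F(ψ₁,φ₁,φ₂) = −8(n_{1,8}−1)φ₁³ − (3/2)(n13b − 2n_{1,8} + 2·n23b + 2)φ₁²φ₂ + (3/2)(n13b + 2n_{1,8} + 2·n23b − 2)φ₁φ₂² − (n13b + 8n_{1,8} + 2·n23b − 8)φ₂³ − (n_{2,1} + 8n_{3,1} − 8)ψ₁³ − 6·n23b·ψ₁²φ₂. -/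
/-- The one-loop prepotential of the SU(2)×SU(3)-model in chamber 4
(`0 < ψ₁ < φ₂−φ₁ < φ₁ < φ₂`). -/
theorem su2su3_prepotential_chamber_four
    (n21 n13 n13bar n23 n23bar n31 n18 : ℝ) (ψ₁ φ₁ φ₂ : ℝ)
    (h1 : 0 < ψ₁) (h2 : ψ₁ < φ₂ - φ₁) (h3 : φ₂ - φ₁ < φ₁) (h4 : φ₁ < φ₂) :
    sixPrepotential n21 n13 n13bar n23 n23bar n31 n18 ψ₁ φ₁ φ₂ =
      -8 * (n18 - 1) * φ₁ ^ 3
      - (3 / 2) * ((n13 + n13bar) - 2 * n18 + 2 * (n23 + n23bar) + 2) * φ₁ ^ 2 * φ₂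
      + (3 / 2) * ((n13 + n13bar) + 2 * n18 + 2 * (n23 + n23bar) - 2) * φ₁ * φ₂ ^ 2
      - ((n13 + n13bar) + 8 * n18 + 2 * (n23 + n23bar) - 8) * φ₂ ^ 3
      - (n21 + 8 * n31 - 8) * ψ₁ ^ 3
      - 6 * (n23 + n23bar) * ψ₁ ^ 2 * φ₂ := by
  unfold sixPrepotential
  rw [abs_of_pos (by linarith : 0 < 2 * ψ₁), abs_of_pos (by linarith : 0 < 2 * φ₁ - φ₂),
    abs_of_pos (by linarith : 0 < -φ₁ + 2 * φ₂), abs_of_pos (by linarith : 0 < φ₁ + φ₂),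
    abs_of_pos h1, abs_of_pos (by linarith : 0 < φ₁), abs_of_pos (by linarith : 0 < -φ₁ + φ₂),
    abs_of_pos (by linarith : 0 < φ₂), abs_of_pos (by linarith : 0 < ψ₁ + φ₁),
    abs_of_neg (by linarith : ψ₁ - φ₁ < 0), abs_of_pos (by linarith : 0 < ψ₁ - φ₁ + φ₂),
    abs_of_neg (by linarith : ψ₁ + φ₁ - φ₂ < 0), abs_of_neg (by linarith : ψ₁ - φ₂ < 0),
    abs_of_pos (by linarith : 0 < ψ₁ + φ₂)]
  ring
end

section
/- Let L, S, T, n_{2,1}, n_{1,3}, n_{1,3̄}, n_{2,3}, n_{2,3̄}, n_{3,1}, n_{1,8} be real numbers and write n13b = n_{1,3}+n_{1,3̄}, n23b = n_{2,3}+n_{2,3̄}. Then the identity −2S(2L+S)ψ₁³ − 6ST·ψ₁(φ₁² − φ₁φ₂ + φ₂²) − 4T(T−L)φ₁³ − 3T(5L−S−2T)φ₁²φ₂ − 3T(−4L+S+T)φ₁φ₂² − T(5L−2S+T)φ₂³ = −8(n_{1,8}−1)φ₁³ − (3/2)(n13b − 2n_{1,8} + 2)φ₁²φ₂ + (3/2)(n13b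 + 2n_{1,8} − 2)φ₁φ₂² + (−n13b − 8n_{1,8} + 8)φ₂³ − (n_{2,1} + 3·n23b + 8n_{3,1} − 8)ψ₁³ − 6·n23b·ψ₁(φ₁² − φ₁φ₂ + φ₂²) holds for ALL real ψ₁, φ₁, φ₂ if and only if the charged-matter relations hold: n_{1,8} = (1/2)(−LT + T² + 2), n13b = T(9L − 2S − 3T), n23b = ST, and n_{2,1} + 8n_{3,1} = 4LS + 2S² − 3ST + 8. (Matching of the triple intersection polynomial of resolution I, restricted to the Cartan fibral divisors ψ₀ = φ₀ = 0, with six times the chamber-1 prepotential.) -/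
/-- Matching the triple intersection polynomial of resolution I of the
SU(2)×SU(3)-model (restricted to ψ₀ = φ₀ = 0) with six times the chamber-1
prepotential holds identically in (ψ₁, φ₁, φ₂) iff the charged-matter
relations hold. -/
theorem su2su3_matching_resolution_I
    (L S T n21 n13 n13bar n23 n23bar n31 n18 : ℝ) :
    (∀ ψ₁ φ₁ φ₂ : ℝ,
      -2 * S * (2 * L + S) * ψ₁ ^ 3
        - 6 * S * T * ψ₁ * (φ₁ ^ 2 - φ₁ * φ₂ + φ₂ ^ 2)
        - 4 * T * (T - L) * φ₁ ^ 3
        - 3 * T * (5 * L - S - 2 * T) * φ₁ ^ 2 * φ₂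
        - 3 * T * (-4 * L + S + T) * φ₁ * φ₂ ^ 2
        - T * (5 * L - 2 * S + T) * φ₂ ^ 3 =
      -8 * (n18 - 1) * φ₁ ^ 3
        - (3 / 2) * ((n13 + n13bar) - 2 * n18 + 2) * φ₁ ^ 2 * φ₂
        + (3 / 2) * ((n13 + n13bar) + 2 * n18 - 2) * φ₁ * φ₂ ^ 2
        + (-(n13 + n13bar) - 8 * n18 + 8) * φ₂ ^ 3
        - (n21 + 3 * (n23 + n23bar) + 8 * n31 - 8) * ψ₁ ^ 3
        - 6 * (n23 + n23bar) * ψ₁ * (φ₁ ^ 2 - φ₁ * φ₂ + φ₂ ^ 2)) ↔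
    (n18 = (1 / 2) * (-L * T + T ^ 2 + 2) ∧
      n13 + n13bar = T * (9 * L - 2 * S - 3 * T) ∧
      n23 + n23bar = S * T ∧
      n21 + 8 * n31 = 4 * L * S + 2 * S ^ 2 - 3 * S * T + 8) := by
  constructor
  · intro h
    have hφ₁ := h 0 1 0
    have hφ₂ := h 0 0 1
    have hψ₁ := h 1 0 0
    have hψφ := h 1 1 0
    refine ⟨?_, ?_, ?_, ?_⟩ <;> linarith
  · rintro ⟨h18, h13, h23, h21⟩ ψ₁ φ₁ φ₂
    rw [h13, h23, h18, eq_sub_of_add_eq h21]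
    ring
end

section
/- Let L, S, T, n_{2,1}, n_{1,3}, n_{1,3̄}, n_{2,3}, n_{2,3̄}, n_{3,1}, n_{1,8} be real numbers and write n13b = n_{1,3}+n_{1,3̄}, n23b = n_{2,3}+n_{2,3̄}. Then the identity −S(4L+2S−T)ψ₁³ + 3T(−5L+S+2T)φ₁²φ₂ − 3T(−4L+S+T)φ₁φ₂² + 4T(L−T)φ₁³ + T(−5L+S−T)φ₂³ − 3ST·ψ₁²φ₂ − 3ST·ψ₁(2φ₁² − 2φ₁φ₂ + φ₂²) = −8(n_{1,8}−1)φ₁³ − (3/2)(n13b − 2n_{1,8} + 2)φ₁²φ₂ + (3/2)(n13b + 2n_{1,8} − 2)φ₁φ₂² − (n13b + 8n_{1,8} + n23b − 8)φ₂³ − (n_{2,1} + 2·n23b + 8n_{3,1} − 8)ψ₁³ − 3·n23b·ψ₁²φ₂ − 3·n23b·ψ₁(2φ₁² − 2φ₁φ₂ + φ₂²) holds for ALL real ψ₁, φ₁, φ₂ if and only if the charged-matter relations hold: n_{1,8} = (1/2)(−LT + T² + 2), n13b = T(9L − 2S − 3T), n23b = ST, and n_{2,1} + 8n_{3,1} =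 4LS + 2S² − 3ST + 8. (Matching of the triple intersection polynomial of resolution II, restricted to the Cartan fibral divisors ψ₀ = φ₀ = 0, with six times the chamber-2 prepotential.) -/
/-- Matching the triple intersection polynomial of resolution II of the
SU(2)×SU(3)-model (restricted to ψ₀ = φ₀ = 0) with six times the chamber-2
prepotential holds identically in (ψ₁, φ₁, φ₂) iff the charged-matter
relations hold. -/
theorem su2su3_matching_resolution_II
    (L S T n21 n13 n13bar n23 n23bar n31 n18 : ℝ) :
    (∀ ψ₁ φ₁ φ₂ : ℝ,
      -S * (4 * L + 2 * S - T) * ψ₁ ^ 3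
        + 3 * T * (-5 * L + S + 2 * T) * φ₁ ^ 2 * φ₂
        - 3 * T * (-4 * L + S + T) * φ₁ * φ₂ ^ 2
        + 4 * T * (L - T) * φ₁ ^ 3
        + T * (-5 * L + S - T) * φ₂ ^ 3
        - 3 * S * T * ψ₁ ^ 2 * φ₂
        - 3 * S * T * ψ₁ * (2 * φ₁ ^ 2 - 2 * φ₁ * φ₂ + φ₂ ^ 2) =
      -8 * (n18 - 1) * φ₁ ^ 3
        - (3 / 2) * ((n13 + n13bar) - 2 * n18 + 2) * φ₁ ^ 2 * φ₂
        + (3 / 2) * ((n13 + n13bar) + 2 * n18 - 2) * φ₁ * φ₂ ^ 2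
        - ((n13 + n13bar) + 8 * n18 + (n23 + n23bar) - 8) * φ₂ ^ 3
        - (n21 + 2 * (n23 + n23bar) + 8 * n31 - 8) * ψ₁ ^ 3
        - 3 * (n23 + n23bar) * ψ₁ ^ 2 * φ₂
        - 3 * (n23 + n23bar) * ψ₁ * (2 * φ₁ ^ 2 - 2 * φ₁ * φ₂ + φ₂ ^ 2)) ↔
    (n18 = (1 / 2) * (-L * T + T ^ 2 + 2) ∧
      n13 + n13bar = T * (9 * L - 2 * S - 3 * T) ∧
      n23 + n23bar = S * T ∧
      n21 + 8 * n31 = 4 * L * S + 2 * S ^ 2 - 3 * S * T + 8) := by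
  constructor
  · intro h
    have hφ₁ := h 0 1 0
    have hφ₂ := h 0 0 1
    have hψ₁ := h 1 0 0
    have hmixed := h 1 1 0
    ring_nf at *
    refine ⟨?_, ?_, ?_, ?_⟩ <;> linarith
  · rintro ⟨h18, h13, h23, h21⟩ ψ₁ φ₁ φ₂
    have hn21 : n21 = 4 * L * S + 2 * S ^ 2 - 3 * S * T + 8 - 8 * n31 := by linarith
    rw [h13, h23, h18, hn21]
    ring
end

section
/- Let L, S, T, n_{2,1}, n_{1,3}, n_{1,3̄}, n_{2,3}, n_{2,3̄}, n_{3,1}, n_{1,8} be real numbers and write n13b = n_{1,3}+n_{1,3̄}, n23b = n_{2,3}+n_{2,3̄}. Then the identity −2S(2L+S−T)ψ₁³ − T(−4L+S+4T)φ₁³ − 3T(5L−S−2T)φ₁²φ₂ − 3T(−4L+S+T)φ₁φ₂² − T(5L−S+T)φ₂³ − 3ST·ψ₁(φ₁ − φ₂)² − 3ST·ψ₁²(φ₁ + φ₂) = −(8n_{1,8} + n23b − 8)φ₁³ − (3/2)(n13b − 2n_{1,8} + 2)φ₁²φ₂ + (3/2)(n13b + 2n_{1,8} − 2)φ₁φ₂²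 − (n13b + 8n_{1,8} + n23b − 8)φ₂³ − (n_{2,1} + n23b + 8n_{3,1} − 8)ψ₁³ − 3·n23b·ψ₁²(φ₁ + φ₂) − 3·n23b·ψ₁(φ₁² − 2φ₁φ₂ + φ₂²) holds for ALL real ψ₁, φ₁, φ₂ if and only if the charged-matter relations hold: n_{1,8} = (1/2)(−LT + T² + 2), n13b = T(9L − 2S − 3T), n23b = ST, and n_{2,1} + 8n_{3,1} = 4LS + 2S² − 3ST + 8. (Matching of the triple intersection polynomial of resolution III, restricted to the Cartan fibral divisors ψ₀ = φ₀ = 0, with six times the chamber-3 prepotential.) -/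
/-- Matching the triple intersection polynomial of resolution III of the
SU(2)×SU(3)-model (restricted to ψ₀ = φ₀ = 0) with six times the chamber-3
prepotential holds identically in (ψ₁, φ₁, φ₂) iff the charged-matter
relations hold. -/
theorem su2su3_matching_resolution_III
    (L S T n21 n13 n13bar n23 n23bar n31 n18 : ℝ) :
    (∀ ψ₁ φ₁ φ₂ : ℝ,
      -2 * S * (2 * L + S - T) * ψ₁ ^ 3
        - T * (-4 * L + S + 4 * T) * φ₁ ^ 3
        - 3 * T * (5 * L - S - 2 * T) * φ₁ ^ 2 * φ₂
        - 3 * T * (-4 * L + S + T) * φ₁ * φ₂ ^ 2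
        - T * (5 * L - S + T) * φ₂ ^ 3
        - 3 * S * T * ψ₁ * (φ₁ - φ₂) ^ 2
        - 3 * S * T * ψ₁ ^ 2 * (φ₁ + φ₂) =
      -(8 * n18 + (n23 + n23bar) - 8) * φ₁ ^ 3
        - (3 / 2) * ((n13 + n13bar) - 2 * n18 + 2) * φ₁ ^ 2 * φ₂
        + (3 / 2) * ((n13 + n13bar) + 2 * n18 - 2) * φ₁ * φ₂ ^ 2
        - ((n13 + n13bar) + 8 * n18 + (n23 + n23bar) - 8) * φ₂ ^ 3
        - (n21 + (n23 + n23bar) + 8 * n31 - 8) * ψ₁ ^ 3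
        - 3 * (n23 + n23bar) * ψ₁ ^ 2 * (φ₁ + φ₂)
        - 3 * (n23 + n23bar) * ψ₁ * (φ₁ ^ 2 - 2 * φ₁ * φ₂ + φ₂ ^ 2)) ↔
    (n18 = (1 / 2) * (-L * T + T ^ 2 + 2) ∧
      n13 + n13bar = T * (9 * L - 2 * S - 3 * T) ∧
      n23 + n23bar = S * T ∧
      n21 + 8 * n31 = 4 * L * S + 2 * S ^ 2 - 3 * S * T + 8) := by
  constructor
  · intro h
    have hψ := h 1 0 0
    have hφ₁ := h 0 1 0
    have hφ₂ := h 0 0 1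
    have hmixed := h 1 1 0
    have h23 : n23 + n23bar = S * T := by linarith
    refine ⟨?_, ?_, h23, ?_⟩ <;> linarith
  · rintro ⟨h18, h13, h23, h21⟩ ψ₁ φ₁ φ₂
    obtain rfl : n21 = 4 * L * S + 2 * S ^ 2 - 3 * S * T + 8 - 8 * n31 := by linarith
    rw [h18, h13, h23]
    ring
end

section
/- Let L, S, T, n_{2,1}, n_{1,3}, n_{1,3̄}, n_{2,3}, n_{2,3̄}, n_{3,1}, n_{1,8} be real numbers and write n13b = n_{1,3}+n_{1,3̄}, n23b = n_{2,3}+n_{2,3̄}. Then the identity S(−4L−2S+3T)ψ₁³ − 4T(T−L)φ₁³ − 3T(5L−2T)φ₁²φ₂ − 3T(T−4L)φ₁φ₂² − T(5L+T)φ₂³ − 6ST·ψ₁²φ₂ = −8(n_{1,8}−1)φ₁³ − (3/2)(n13b − 2n_{1,8} + 2·n23b + 2)φ₁²φ₂ + (3/2)(n13b + 2n_{1,8} + 2·n23b − 2)φ₁φ₂² − (n13b + 8n_{1,8} + 2·n23b − 8)φ₂³ − (n_{2,1} + 8n_{3,1} − 8)ψ₁³ − 6·n23b·ψ₁²φ₂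 holds for ALL real ψ₁, φ₁, φ₂ if and only if the charged-matter relations hold: n_{1,8} = (1/2)(−LT + T² + 2), n13b = T(9L − 2S − 3T), n23b = ST, and n_{2,1} + 8n_{3,1} = 4LS + 2S² − 3ST + 8. (Matching of the triple intersection polynomial of resolution IV, restricted to the Cartan fibral divisors ψ₀ = φ₀ = 0, with six times the chamber-4 prepotential.) -/
/-- Matching the triple intersection polynomial of resolution IV of the
SU(2)×SU(3)-model (restricted to ψ₀ = φ₀ = 0) with six times the chamber-4
prepotential holds identically in (ψ₁, φ₁, φ₂) iff the charged-matter
relations hold. -/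
theorem su2su3_matching_resolution_IV
    (L S T n21 n13 n13bar n23 n23bar n31 n18 : ℝ) :
    (∀ ψ₁ φ₁ φ₂ : ℝ,
      S * (-4 * L - 2 * S + 3 * T) * ψ₁ ^ 3
        - 4 * T * (T - L) * φ₁ ^ 3
        - 3 * T * (5 * L - 2 * T) * φ₁ ^ 2 * φ₂
        - 3 * T * (T - 4 * L) * φ₁ * φ₂ ^ 2
        - T * (5 * L + T) * φ₂ ^ 3
        - 6 * S * T * ψ₁ ^ 2 * φ₂ =
      -8 * (n18 - 1) * φ₁ ^ 3
        - (3 / 2) * ((n13 + n13bar) - 2 * n18 + 2 * (n23 + n23bar) + 2) * φ₁ ^ 2 * φ₂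
        + (3 / 2) * ((n13 + n13bar) + 2 * n18 + 2 * (n23 + n23bar) - 2) * φ₁ * φ₂ ^ 2
        - ((n13 + n13bar) + 8 * n18 + 2 * (n23 + n23bar) - 8) * φ₂ ^ 3
        - (n21 + 8 * n31 - 8) * ψ₁ ^ 3
        - 6 * (n23 + n23bar) * ψ₁ ^ 2 * φ₂) ↔
    (n18 = (1 / 2) * (-L * T + T ^ 2 + 2) ∧
      n13 + n13bar = T * (9 * L - 2 * S - 3 * T) ∧
      n23 + n23bar = S * T ∧
      n21 + 8 * n31 = 4 * L * S + 2 * S ^ 2 - 3 * S * T + 8) := by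
  constructor
  · intro h
    have hψ := h 1 0 0
    have hφ₁ := h 0 1 0
    have hφ₂ := h 0 0 1
    have hψφ₂ := h 1 0 1
    have h_n18 : n18 = (1 / 2) * (-L * T + T ^ 2 + 2) := by linarith
    have h_n23 : n23 + n23bar = S * T := by linarith
    exact ⟨h_n18, by linarith, h_n23, by linarith⟩
  · rintro ⟨h_n18, h_n13, h_n23, h_n21⟩ ψ₁ φ₁ φ₂
    rw [h_n18, h_n13, h_n23, h_n21]
    ring
end
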